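/- arXiv:2603.10177 — 3 statements merged into one kernel-verified Lean document; each statement's English description precedes it below -/
import Mathlib

section
/- For every integer k ≥ 2, the hypergraph H_k† satisfies κ(H_k†) = k. -/
open Finset

variable {α : Type*} [DecidableEq α]

/-- Total weights achievable by fractional edge covers of the hypergraph `(V, E)`. -/
def coverWeights (V : Finset α) (E : Finset (Finset α)) : Set ℝ :=
  {w | ∃ u : Finset α → ℝ, (∀ e ∈ E, 0 ≤ u e) ∧
    (∀ v ∈ V, 1 ≤ ∑ e ∈ E.filter (fun e => v ∈ e), u e) ∧
    w = ∑ e ∈ E, u e}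

/-- Total weights achievable by fractional edge packings of the hypergraph `(V, E)`. -/
def packingWeights (V : Finset α) (E : Finset (Finset α)) : Set ℝ :=
  {w | ∃ u : Finset α → ℝ, (∀ e ∈ E, 0 ≤ u e) ∧
    (∀ v ∈ V, ∑ e ∈ E.filter (fun e => v ∈ e), u e ≤ 1) ∧
    w = ∑ e ∈ E, u e}

/-- `ρ*`: the minimum total weight of a fractional edge cover. -/
noncomputable def rhoStar (V : Finset α) (E : Finset (Finset α)) : ℝ :=
  sInf (coverWeights V E)

/-- `τ*`: the maximum total weight of a fractional edge packing. -/
noncomputable def tauStar (V : Finset α) (E : Finset (Finset α)) : ℝ :=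
  sSup (packingWeights V E)

/-- Edge set of the induced subhypergraph `H[S]`. -/
def induced (E : Finset (Finset α)) (S : Finset α) : Finset (Finset α) :=
  (E.image (fun e => e ∩ S)).filter (fun e => e ≠ ∅)

/-- Edge set of the reduced hypergraph `red(H)`: edges strictly contained in
another edge are removed. -/
def reduce (E : Finset (Finset α)) : Finset (Finset α) :=
  E.filter (fun e => ∀ e' ∈ E, e ⊆ e' → e = e')

/-- `κ`: the reduced quasi vertex-cover. -/
noncomputable def kappa (V : Finset α) (E : Finset (Finset α)) : ℝ :=
  V.powerset.sup' V.powerset_nonempty (fun S => tauStar S (reduce (induced E S)))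

/-- `ψ*`: the edge quasi-packing. -/
noncomputable def psiStar (V : Finset α) (E : Finset (Finset α)) : ℝ :=
  V.powerset.sup' V.powerset_nonempty (fun S => tauStar S (induced E S))

/-- Vertex type of the hypergraph `H_k†`: the `x_i`s, the `y_i`s, and `z`. -/
abbrev DagVert (k : ℕ) := (Fin k ⊕ Fin k) ⊕ Unit

/-- The hyperedge `{x_1, …, x_k, z}`. -/
def dagXEdge (k : ℕ) : Finset (DagVert k) :=
  (Finset.univ.image (fun i : Fin k => (Sum.inl (Sum.inl i) : DagVert k))) ∪ {Sum.inr ()}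

/-- The hyperedge `{y_1, …, y_k, z}`. -/
def dagYEdge (k : ℕ) : Finset (DagVert k) :=
  (Finset.univ.image (fun i : Fin k => (Sum.inl (Sum.inr i) : DagVert k))) ∪ {Sum.inr ()}

/-- The edge set of `H_k†`: `{x_1,…,x_k,z}`, `{y_1,…,y_k,z}`, and `{x_i, y_i, z}`
for each `i`. -/
def dagEdges (k : ℕ) : Finset (Finset (DagVert k)) :=
  {dagXEdge k, dagYEdge k} ∪
    Finset.univ.image (fun i : Fin k =>
      ({Sum.inl (Sum.inl i), Sum.inl (Sum.inr i), Sum.inr ()} : Finset (DagVert k)))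

/-- Weak duality: a fractional vertex cover bounds every fractional edge packing. -/
theorem packingWeights_le_sum {V : Finset α} {E : Finset (Finset α)} {w : ℝ}
    (hw : w ∈ packingWeights V E) (c : α → ℝ) (hc : ∀ v, 0 ≤ c v)
    (hE : ∀ e ∈ E, 1 ≤ ∑ v ∈ V.filter (fun v => v ∈ e), c v) :
    w ≤ ∑ v ∈ V, c v := by
  obtain ⟨u, hu0, hu1, rfl⟩ := hw
  calc ∑ e ∈ E, u e
      ≤ ∑ e ∈ E, u e * ∑ v ∈ V.filter (fun v => v ∈ e), c v :=
        sum_le_sum fun e he => le_mul_of_one_le_right (hu0 e he) (hE e he)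
    _ = ∑ v ∈ V, c v * ∑ e ∈ E.filter (fun e => v ∈ e), u e := by
        simp only [sum_filter, mul_sum]
        rw [sum_comm]
        refine sum_congr rfl fun v _ => sum_congr rfl fun e _ => ?_
        split_ifs <;> ring
    _ ≤ ∑ v ∈ V, c v :=
        sum_le_sum fun v hv => mul_le_of_le_one_right (hc v) (hu1 v hv)

/-- The size of a transversal bounds every fractional edge packing. -/
theorem packingWeights_le_card {V : Finset α} {E : Finset (Finset α)} {w : ℝ}
    (hw : w ∈ packingWeights V E) (T : Finset α)
    (hT : ∀ e ∈ E, ∃ v ∈ T, v ∈ V ∧ v ∈ e) : w ≤ #T := by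
  have h := packingWeights_le_sum hw (fun v => if v ∈ T then 1 else 0)
    (fun v => by split_ifs <;> norm_num) (fun e he => by
      obtain ⟨v, hvT, hvV, hve⟩ := hT e he
      have := single_le_sum (f := fun v => if v ∈ T then (1 : ℝ) else 0)
        (s := V.filter (fun v => v ∈ e)) (fun v _ => by split_ifs <;> norm_num)
        (mem_filter.2 ⟨hvV, hve⟩)
      simpa [hvT] using this)
  refine h.trans ?_
  rw [sum_boole]
  exact_mod_cast card_le_card fun v hv => (mem_filter.1 hv).2

/-- If all hyperedges have at least two vertices, half the number of vertices bounds every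
fractional edge packing. -/
theorem packingWeights_le_half_card {V : Finset α} {E : Finset (Finset α)} {w : ℝ}
    (hw : w ∈ packingWeights V E) (hV : ∀ e ∈ E, e ⊆ V) (hE : ∀ e ∈ E, 2 ≤ #e) :
    w ≤ #V / 2 := by
  have h := packingWeights_le_sum hw (fun _ => 1 / 2) (fun v => by norm_num) (fun e he => by
      have h1 : V.filter (fun v => v ∈ e) = e := by
        ext v
        simpa using fun hv => hV e he hv
      have h2 : (2 : ℝ) ≤ #e := by exact_mod_cast hE e he
      rw [h1, sum_const, nsmul_eq_mul]
      linarith)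
  rw [sum_const, nsmul_eq_mul] at h
  linarith

theorem mem_induced {E : Finset (Finset α)} {S e : Finset α} :
    e ∈ induced E S ↔ (∃ g ∈ E, g ∩ S = e) ∧ e.Nonempty := by
  simp [induced, nonempty_iff_ne_empty]

theorem mem_reduce {E : Finset (Finset α)} {e : Finset α} :
    e ∈ reduce E ↔ e ∈ E ∧ ∀ e' ∈ E, e ⊆ e' → e = e' := by
  simp [reduce]

theorem subset_of_mem_reduce_induced {E : Finset (Finset α)} {S e : Finset α}
    (he : e ∈ reduce (induced E S)) : e ⊆ S := by
  obtain ⟨⟨g, -, rfl⟩, -⟩ := mem_induced.1 (mem_reduce.1 he).1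
  exact inter_subset_right

theorem mem_dagEdges {k : ℕ} {e : Finset (DagVert k)} :
    e ∈ dagEdges k ↔ e = dagXEdge k ∨ e = dagYEdge k ∨
      ∃ i : Fin k, {Sum.inl (Sum.inl i), Sum.inl (Sum.inr i), Sum.inr ()} = e := by
  simp [dagEdges]

theorem inr_mem_of_mem_dagEdges {k : ℕ} {e : Finset (DagVert k)} (he : e ∈ dagEdges k) :
    Sum.inr () ∈ e := by
  rcases mem_dagEdges.1 he with rfl | rfl | ⟨i, rfl⟩ <;> simp [dagXEdge, dagYEdge]

/-- The hyperedges of `red(H_k†[S])` when `z ∉ S`. -/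
theorem mem_reduce_induced_dagEdges {k : ℕ} {S e : Finset (DagVert k)}
    (hz : Sum.inr () ∉ S) (he : e ∈ reduce (induced (dagEdges k) S)) :
    e = dagXEdge k ∩ S ∨ e = dagYEdge k ∩ S ∨
      ∃ i : Fin k, Sum.inl (Sum.inl i) ∈ S ∧ Sum.inl (Sum.inr i) ∈ S ∧
        e = {Sum.inl (Sum.inl i), Sum.inl (Sum.inr i)} := by
  obtain ⟨he, hmax⟩ := mem_reduce.1 he
  obtain ⟨⟨g, hg, rfl⟩, hne⟩ := mem_induced.1 he
  rcases mem_dagEdges.1 hg with rfl | rfl | ⟨i, rfl⟩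
  · exact Or.inl rfl
  · exact Or.inr (Or.inl rfl)
  by_cases hx : Sum.inl (Sum.inl i) ∈ S
  · by_cases hy : Sum.inl (Sum.inr i) ∈ S
    · refine Or.inr (Or.inr ⟨i, hx, hy, ?_⟩)
      ext v
      simp only [mem_inter, mem_insert, mem_singleton]
      grind
    · have hsub : ({Sum.inl (Sum.inl i), Sum.inl (Sum.inr i), Sum.inr ()} :
          Finset (DagVert k)) ∩ S ⊆ dagXEdge k ∩ S := by
        intro v hv
        simp only [dagXEdge, mem_inter, mem_insert, mem_singleton, mem_union, mem_image] at hv ⊢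
        grind
      exact Or.inl (hmax _ (mem_induced.2
        ⟨⟨_, mem_dagEdges.2 (Or.inl rfl), rfl⟩, hne.mono hsub⟩) hsub)
  · have hsub : ({Sum.inl (Sum.inl i), Sum.inl (Sum.inr i), Sum.inr ()} :
        Finset (DagVert k)) ∩ S ⊆ dagYEdge k ∩ S := by
      intro v hv
      simp only [dagYEdge, mem_inter, mem_insert, mem_singleton, mem_union, mem_image] at hv ⊢
      grind
    exact Or.inr (Or.inl (hmax _ (mem_induced.2
      ⟨⟨_, mem_dagEdges.2 (Or.inr (Or.inl rfl)), rfl⟩, hne.mono hsub⟩) hsub))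

theorem packingWeights_dag_le {k : ℕ} (hk : 2 ≤ k) {S : Finset (DagVert k)} {w : ℝ}
    (hw : w ∈ packingWeights S (reduce (induced (dagEdges k) S))) : w ≤ k := by
  by_cases hz : Sum.inr () ∈ S
  · refine (packingWeights_le_card hw {Sum.inr ()} fun e he => ?_).trans ?_
    · obtain ⟨⟨g, hg, rfl⟩, -⟩ := mem_induced.1 (mem_reduce.1 he).1
      exact ⟨_, mem_singleton_self _, hz, mem_inter.2 ⟨inr_mem_of_mem_dagEdges hg, hz⟩⟩
    · rw [card_singleton]
      exact_mod_cast (by omega : 1 ≤ k)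
  have hne : ∀ e ∈ reduce (induced (dagEdges k) S), e.Nonempty :=
    fun e he => (mem_induced.1 (mem_reduce.1 he).1).2
  have hX : ∀ v ∈ dagXEdge k ∩ S, ∃ i : Fin k, v = Sum.inl (Sum.inl i) ∧ v ∈ S := by
    intro v hv
    simp only [dagXEdge, mem_inter, mem_singleton, mem_union, mem_image] at hv
    grind
  have hY : ∀ v ∈ dagYEdge k ∩ S, ∃ i : Fin k, v = Sum.inl (Sum.inr i) ∧ v ∈ S := by
    intro v hv
    simp only [dagYEdge, mem_inter, mem_singleton, mem_union, mem_image] at hv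
    grind
  have hX' : ∀ i : Fin k, Sum.inl (Sum.inl i) ∈ S → Sum.inl (Sum.inl i) ∈ dagXEdge k ∩ S := by
    intro i hi
    simpa [dagXEdge] using hi
  have hY' : ∀ i : Fin k, Sum.inl (Sum.inr i) ∈ S → Sum.inl (Sum.inr i) ∈ dagYEdge k ∩ S := by
    intro i hi
    simpa [dagYEdge] using hi
  set C : Finset (Fin k) :=
    univ.filter fun i => Sum.inl (Sum.inl i) ∈ S ∧ Sum.inl (Sum.inr i) ∈ S with hC
  have hmemC : ∀ i, i ∈ C ↔ Sum.inl (Sum.inl i) ∈ S ∧ Sum.inl (Sum.inr i) ∈ S := by simp [hC]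
  by_cases hfull : C = univ
  · have hall : ∀ i : Fin k, Sum.inl (Sum.inl i) ∈ S ∧ Sum.inl (Sum.inr i) ∈ S :=
      fun i => (hmemC i).1 (hfull ▸ mem_univ i)
    have hcard : #S ≤ 2 * k := by
      have hsub : S ⊆ univ.map ⟨Sum.inl, Sum.inl_injective⟩ := by
        rintro (v | v) hv
        · simp
        · exact absurd hv hz
      simpa [two_mul] using card_le_card hsub
    refine (packingWeights_le_half_card hw (fun e he => subset_of_mem_reduce_induced he)
      fun e he => ?_).trans ?_
    · refine one_lt_card.2 ?_
      rcases mem_reduce_induced_dagEdges hz he with rfl | rfl | ⟨i, -, -, rfl⟩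
      · exact ⟨_, hX' ⟨0, by omega⟩ (hall _).1, _, hX' ⟨1, by omega⟩ (hall _).1, by simp⟩
      · exact ⟨_, hY' ⟨0, by omega⟩ (hall _).2, _, hY' ⟨1, by omega⟩ (hall _).2, by simp⟩
      · exact ⟨Sum.inl (Sum.inl i), by simp, Sum.inl (Sum.inr i), by simp, by simp⟩
    · have : (#S : ℝ) ≤ 2 * k := by exact_mod_cast hcard
      linarith
  rcases C.eq_empty_or_nonempty with hC0 | ⟨j, hj⟩
  · have hex : ∀ f : Fin k → DagVert k, ∃ a, ∀ i, f i ∈ S → f a ∈ S := by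
      intro f
      by_cases h : ∃ a, f a ∈ S
      · exact h.imp fun a ha _ _ => ha
      · exact ⟨⟨0, by omega⟩, fun i hi => absurd ⟨i, hi⟩ h⟩
    obtain ⟨a, ha⟩ := hex fun i => Sum.inl (Sum.inl i)
    obtain ⟨b, hb⟩ := hex fun i => Sum.inl (Sum.inr i)
    refine (packingWeights_le_card hw {Sum.inl (Sum.inl a), Sum.inl (Sum.inr b)}
      fun e he => ?_).trans (by exact_mod_cast card_le_two.trans hk)
    obtain ⟨v, hv⟩ := hne e he
    rcases mem_reduce_induced_dagEdges hz he with rfl | rfl | ⟨i, hi, hi', rfl⟩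
    · obtain ⟨i, rfl, hi⟩ := hX v hv
      exact ⟨_, by simp, ha i hi, hX' a (ha i hi)⟩
    · obtain ⟨i, rfl, hi⟩ := hY v hv
      exact ⟨Sum.inl (Sum.inr b), by simp, hb i hi, hY' b (hb i hi)⟩
    · exact absurd ((hmemC i).2 ⟨hi, hi'⟩) (by simp [hC0])
  · refine (packingWeights_le_card hw
      (insert (Sum.inl (Sum.inr j)) (C.image fun i => Sum.inl (Sum.inl i)))
      fun e he => ?_).trans ?_
    · obtain ⟨hjx, hjy⟩ := (hmemC j).1 hj
      rcases mem_reduce_induced_dagEdges hz he with rfl | rfl | ⟨i, hi, hi', rfl⟩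
      · exact ⟨Sum.inl (Sum.inl j), by simp [hj], hjx, hX' j hjx⟩
      · exact ⟨Sum.inl (Sum.inr j), by simp, hjy, hY' j hjy⟩
      · have hiC := (hmemC i).2 ⟨hi, hi'⟩
        exact ⟨Sum.inl (Sum.inl i), by simp [hiC], hi, by simp⟩
    · have h1 : #C < k := by
        simpa using card_lt_card (ssubset_univ_iff.2 hfull)
      have h2 := (card_insert_le (Sum.inl (Sum.inr j) : DagVert k)
        (C.image fun i => Sum.inl (Sum.inl i))).trans
        (Nat.add_le_add_right card_image_le 1)
      exact_mod_cast h2.trans h1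

/-- Removing `z` from `H_k†` leaves the hyperedges `{x_i, y_i}`, none of which is reduced away. -/
theorem pair_mem_reduce_induced_dagEdges {k : ℕ} (i : Fin k) :
    ({Sum.inl (Sum.inl i), Sum.inl (Sum.inr i)} : Finset (DagVert k)) ∈
      reduce (induced (dagEdges k) (univ.erase (Sum.inr ()))) := by
  refine mem_reduce.2 ⟨mem_induced.2 ⟨⟨_, mem_dagEdges.2 (Or.inr (Or.inr ⟨i, rfl⟩)), ?_⟩,
    by simp⟩, fun e he hsub => ?_⟩
  · ext v
    simp only [mem_inter, mem_insert, mem_singleton, mem_erase, mem_univ]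
    grind
  · obtain ⟨⟨g, hg, rfl⟩, -⟩ := mem_induced.1 he
    have hx := hsub (mem_insert_self _ _)
    have hy := hsub (mem_insert_of_mem (mem_singleton_self _))
    rcases mem_dagEdges.1 hg with rfl | rfl | ⟨j, rfl⟩
    · simp [dagXEdge] at hy
    · simp [dagYEdge] at hx
    · obtain rfl : i = j := by simpa using hx
      ext v
      simp only [mem_inter, mem_insert, mem_singleton, mem_erase, mem_univ]
      grind

theorem natCast_mem_packingWeights_dag (k : ℕ) :
    (k : ℝ) ∈ packingWeights (univ.erase (Sum.inr ()))
      (reduce (induced (dagEdges k) (univ.erase (Sum.inr ())))) := by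
  set P : Finset (Finset (DagVert k)) :=
    univ.image fun i : Fin k => {Sum.inl (Sum.inl i), Sum.inl (Sum.inr i)} with hP
  have hinj : Function.Injective fun i : Fin k =>
      ({Sum.inl (Sum.inl i), Sum.inl (Sum.inr i)} : Finset (DagVert k)) := by
    intro i j hij
    have : Sum.inl (Sum.inl i) ∈
        ({Sum.inl (Sum.inl j), Sum.inl (Sum.inr j)} : Finset (DagVert k)) := by
      exact hij.subset (mem_insert_self _ _)
    simpa using this
  have hcard : #P = k := by rw [hP, card_image_of_injective _ hinj, card_univ, Fintype.card_fin]
  refine ⟨fun e => if e ∈ P then 1 else 0, fun e _ => by dsimp only; split_ifs <;> norm_num,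
    fun v hv => ?_, ?_⟩
  · rw [sum_boole]
    norm_cast
    refine card_le_one.2 fun e he f hf => ?_
    simp only [mem_filter, hP, mem_image, mem_univ, true_and] at he hf
    obtain ⟨⟨-, hve⟩, i, rfl⟩ := he
    obtain ⟨⟨-, hvf⟩, j, rfl⟩ := hf
    simp only [mem_insert, mem_singleton] at hve hvf
    grind
  · rw [sum_boole, filter_mem_eq_inter, inter_eq_right.2, hcard]
    intro e he
    obtain ⟨i, -, rfl⟩ := mem_image.1 he
    exact pair_mem_reduce_induced_dagEdges i

/-- For every integer `k ≥ 2`, `κ(H_k†) = k`. -/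
theorem kappa_dag (k : ℕ) (hk : 2 ≤ k) :
    kappa (Finset.univ : Finset (DagVert k)) (dagEdges k) = k := by
  refine le_antisymm (sup'_le _ _ fun S _ =>
    Real.sSup_le (fun w hw => packingWeights_dag_le hk hw) k.cast_nonneg) ?_
  refine le_trans ?_ (le_sup' _ (mem_powerset.2 (subset_univ (univ.erase (Sum.inr ())))))
  exact le_csSup ⟨k, fun w hw => packingWeights_dag_le hk hw⟩ (natCast_mem_packingWeights_dag k)
end

section
/- For every integer k ≥ 2, the boat hypergraph H_k^B satisfies ρ*(H_k^B) = 2 and τ*(H_k^B) = ψ*(H_k^B) = κ(H_k^B) = k. -/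
open Finset

variable {α : Type*} [DecidableEq α]

/-- Vertex type of the boat hypergraph `H_k^B`: the `x_i`s and the `y_i`s. -/
abbrev BoatVert (k : ℕ) := Fin k ⊕ Fin k

/-- The edge set of `H_k^B`: `{x_1,…,x_k}`, `{y_1,…,y_k}`, and `{x_i, y_i}` for each `i`. -/
def boatEdges (k : ℕ) : Finset (Finset (BoatVert k)) :=
  {Finset.univ.image (Sum.inl : Fin k → BoatVert k),
   Finset.univ.image (Sum.inr : Fin k → BoatVert k)} ∪
    Finset.univ.image (fun i : Fin k =>
      ({Sum.inl i, Sum.inr i} : Finset (BoatVert k)))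

/-- Double counting of incidences between a vertex set and a weighted edge set. -/
theorem sum_incidence_eq (C : Finset α) (E : Finset (Finset α)) (u : Finset α → ℝ) :
    ∑ v ∈ C, ∑ e ∈ E.filter (fun e => v ∈ e), u e = ∑ e ∈ E, ((e ∩ C).card : ℝ) * u e := by
  simp_rw [sum_filter]
  rw [sum_comm]
  refine sum_congr rfl fun e _ => ?_
  rw [← sum_filter, sum_const, nsmul_eq_mul, filter_mem_eq_inter, inter_comm]

/-- A transversal of the edges bounds every fractional edge packing. -/
theorem le_card_of_mem_packingWeights {V C : Finset α} {E : Finset (Finset α)} (hCV : C ⊆ V)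
    (hC : ∀ e ∈ E, (e ∩ C).Nonempty) {w : ℝ} (hw : w ∈ packingWeights V E) : w ≤ C.card := by
  obtain ⟨u, hu, hV, rfl⟩ := hw
  calc ∑ e ∈ E, u e ≤ ∑ e ∈ E, ((e ∩ C).card : ℝ) * u e :=
        sum_le_sum fun e he => le_mul_of_one_le_left (hu e he)
          (by exact_mod_cast (hC e he).card_pos)
    _ = ∑ v ∈ C, ∑ e ∈ E.filter (fun e => v ∈ e), u e := (sum_incidence_eq C E u).symm
    _ ≤ ∑ v ∈ C, (1 : ℝ) := sum_le_sum fun v hv => hV v (hCV hv)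
    _ = C.card := by simp

/-- A vertex set meeting each edge at most once bounds every fractional edge cover from below. -/
theorem card_le_of_mem_coverWeights {V I : Finset α} {E : Finset (Finset α)} (hIV : I ⊆ V)
    (hI : ∀ e ∈ E, (e ∩ I).card ≤ 1) {w : ℝ} (hw : w ∈ coverWeights V E) : (I.card : ℝ) ≤ w := by
  obtain ⟨u, hu, hV, rfl⟩ := hw
  calc (I.card : ℝ) = ∑ v ∈ I, (1 : ℝ) := by simp
    _ ≤ ∑ v ∈ I, ∑ e ∈ E.filter (fun e => v ∈ e), u e := sum_le_sum fun v hv => hV v (hIV hv)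
    _ = ∑ e ∈ E, ((e ∩ I).card : ℝ) * u e := sum_incidence_eq I E u
    _ ≤ ∑ e ∈ E, u e :=
        sum_le_sum fun e he => mul_le_of_le_one_left (hu e he) (by exact_mod_cast hI e he)

theorem card_mem_packingWeights {V : Finset α} {M E : Finset (Finset α)} (hME : M ⊆ E)
    (hM : (M : Set (Finset α)).PairwiseDisjoint id) : (M.card : ℝ) ∈ packingWeights V E := by
  refine ⟨fun e => if e ∈ M then 1 else 0, fun e _ => by dsimp only; split_ifs <;> simp, fun v _ => ?_, ?_⟩
  · rw [sum_boole]
    norm_cast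
    refine card_le_one.2 fun a ha b hb => ?_
    simp only [mem_filter] at ha hb
    by_contra hab
    exact disjoint_left.1 (hM ha.2 hb.2 hab) ha.1.2 hb.1.2
  · rw [sum_boole, filter_mem_eq_inter, inter_eq_right.2 hME]

theorem card_mem_coverWeights {V : Finset α} {M E : Finset (Finset α)} (hME : M ⊆ E)
    (hM : ∀ v ∈ V, ∃ e ∈ M, v ∈ e) : (M.card : ℝ) ∈ coverWeights V E := by
  refine ⟨fun e => if e ∈ M then 1 else 0, fun e _ => by dsimp only; split_ifs <;> simp, fun v hv => ?_, ?_⟩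
  · obtain ⟨e, he, hve⟩ := hM v hv
    rw [sum_boole]
    norm_cast
    exact card_pos.2 ⟨e, by simp [hME he, hve, he]⟩
  · rw [sum_boole, filter_mem_eq_inter, inter_eq_right.2 hME]

theorem tauStar_le_card {V C : Finset α} {E : Finset (Finset α)} (hCV : C ⊆ V)
    (hC : ∀ e ∈ E, (e ∩ C).Nonempty) : tauStar V E ≤ C.card :=
  csSup_le ⟨_, card_mem_packingWeights (empty_subset E) (by simp)⟩
    fun _ hw => le_card_of_mem_packingWeights hCV hC hw

theorem card_le_tauStar {V C : Finset α} {M E : Finset (Finset α)} (hCV : C ⊆ V)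
    (hC : ∀ e ∈ E, (e ∩ C).Nonempty) (hME : M ⊆ E)
    (hM : (M : Set (Finset α)).PairwiseDisjoint id) : (M.card : ℝ) ≤ tauStar V E :=
  le_csSup ⟨C.card, fun _ hw => le_card_of_mem_packingWeights hCV hC hw⟩
    (card_mem_packingWeights hME hM)

theorem rhoStar_eq_card {V I : Finset α} {M E : Finset (Finset α)} (hIV : I ⊆ V)
    (hI : ∀ e ∈ E, (e ∩ I).card ≤ 1) (hME : M ⊆ E) (hM : ∀ v ∈ V, ∃ e ∈ M, v ∈ e)
    (hcard : M.card = I.card) : rhoStar V E = I.card :=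
  IsLeast.csInf_eq ⟨hcard ▸ card_mem_coverWeights hME hM,
    fun _ hw => card_le_of_mem_coverWeights hIV hI hw⟩

theorem induced_univ [Fintype α] {E : Finset (Finset α)} (hE : ∀ e ∈ E, e.Nonempty) :
    induced E univ = E := by
  ext e
  simp only [induced, inter_univ, image_id', mem_filter, and_iff_left_iff_imp]
  exact fun he => (hE e he).ne_empty

theorem reduce_subset (E : Finset (Finset α)) : reduce E ⊆ E := filter_subset _ _

theorem mem_boatEdges {k : ℕ} {e : Finset (BoatVert k)} :
    e ∈ boatEdges k ↔ e = univ.image Sum.inl ∨ e = univ.image Sum.inr ∨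
      ∃ i : Fin k, e = {Sum.inl i, Sum.inr i} := by
  simp [boatEdges, eq_comm]

/-- The rungs `{x_i, y_i}` of the boat hypergraph. -/
def boatRungs (k : ℕ) : Finset (Finset (BoatVert k)) :=
  univ.image fun i : Fin k => {Sum.inl i, Sum.inr i}

theorem card_boatRungs (k : ℕ) : (boatRungs k).card = k := by
  rw [boatRungs, card_image_of_injective, card_univ, Fintype.card_fin]
  intro i j h
  have : (Sum.inl i : BoatVert k) ∈ ({Sum.inl j, Sum.inr j} : Finset (BoatVert k)) := by
    dsimp only at h; rw [← h]; simp
  simpa using this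

theorem pairwiseDisjoint_boatRungs (k : ℕ) :
    (boatRungs k : Set (Finset (BoatVert k))).PairwiseDisjoint id := by
  intro a ha b hb hab
  simp only [boatRungs, coe_image, coe_univ, Set.image_univ, Set.mem_range] at ha hb
  obtain ⟨i, rfl⟩ := ha
  obtain ⟨j, rfl⟩ := hb
  have hij : i ≠ j := by rintro rfl; exact hab rfl
  simp [Function.onFun, hij.symm]

theorem boatRungs_subset (k : ℕ) : boatRungs k ⊆ boatEdges k := subset_union_right

theorem boatRungs_subset_reduce (k : ℕ) : boatRungs k ⊆ reduce (boatEdges k) := by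
  intro e he
  refine mem_reduce.2 ⟨boatRungs_subset k he, fun e' he' hsub => ?_⟩
  obtain ⟨i, -, rfl⟩ := mem_image.1 he
  have hl : Sum.inl i ∈ e' := hsub (by simp)
  have hr : Sum.inr i ∈ e' := hsub (by simp)
  obtain rfl | rfl | ⟨j, rfl⟩ := mem_boatEdges.1 he'
  · simp at hr
  · simp at hl
  · obtain rfl : i = j := by simpa using hl
    rfl

theorem nonempty_of_mem_boatEdges {k : ℕ} (hk : 2 ≤ k) {e : Finset (BoatVert k)}
    (he : e ∈ boatEdges k) : e.Nonempty := by
  have : NeZero k := ⟨by omega⟩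
  obtain rfl | rfl | ⟨j, rfl⟩ := mem_boatEdges.1 he <;> simp

/-- Every induced subhypergraph of the boat hypergraph has a transversal of size at most `k`. -/
theorem exists_boat_transversal {k : ℕ} (hk : 2 ≤ k) (S : Finset (BoatVert k)) :
    ∃ C ⊆ S, C.card ≤ k ∧ ∀ e ∈ induced (boatEdges k) S, (e ∩ C).Nonempty := by
  have key (c : Fin k → BoatVert k)
      (hx : ∀ i, Sum.inl i ∈ S → ∃ j, c j ∈ S ∧ ∃ l, c j = Sum.inl l)
      (hy : ∀ i, Sum.inr i ∈ S → ∃ j, c j ∈ S ∧ ∃ l, c j = Sum.inr l)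
      (hxy : ∀ i, Sum.inl i ∈ S ∨ Sum.inr i ∈ S →
        c i ∈ S ∧ (c i = Sum.inl i ∨ c i = Sum.inr i)) :
      ∃ C ⊆ S, C.card ≤ k ∧ ∀ e ∈ induced (boatEdges k) S, (e ∩ C).Nonempty := by
    refine ⟨univ.image c ∩ S, inter_subset_right,
      (card_le_card inter_subset_left).trans (card_image_le.trans (by simp)), fun e he => ?_⟩
    simp only [induced, mem_filter, mem_image, ← nonempty_iff_ne_empty] at he
    obtain ⟨⟨e, he, rfl⟩, v, hv⟩ := he
    obtain ⟨hv, hvS⟩ := mem_inter.1 hv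
    suffices ∃ j, c j ∈ S ∧ c j ∈ e by
      obtain ⟨j, hjS, hje⟩ := this
      exact ⟨c j, by simp [hjS, hje]⟩
    obtain rfl | rfl | ⟨i, rfl⟩ := mem_boatEdges.1 he
    · obtain ⟨i, -, rfl⟩ := mem_image.1 hv
      obtain ⟨j, hj, l, hl⟩ := hx i hvS
      exact ⟨j, hj, by simp [hl]⟩
    · obtain ⟨i, -, rfl⟩ := mem_image.1 hv
      obtain ⟨j, hj, l, hl⟩ := hy i hvS
      exact ⟨j, hj, by simp [hl]⟩
    · have hi : Sum.inl i ∈ S ∨ Sum.inr i ∈ S := by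
        simp only [mem_insert, mem_singleton] at hv
        rcases hv with rfl | rfl <;> simp [hvS]
      exact ⟨i, (hxy i hi).1, by simpa using (hxy i hi).2⟩
  by_cases hX : ∃ i, Sum.inl i ∈ S
  swap
  · push Not at hX
    exact key Sum.inr (fun i hi => absurd hi (hX i)) (fun i hi => ⟨i, hi, i, rfl⟩)
      (fun i hi => ⟨hi.resolve_left (hX i), .inr rfl⟩)
  by_cases hY : ∃ i, Sum.inr i ∈ S
  swap
  · push Not at hY
    exact key Sum.inl (fun i hi => ⟨i, hi, i, rfl⟩) (fun i hi => absurd hi (hY i))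
      (fun i hi => ⟨hi.resolve_right (hY i), .inl rfl⟩)
  by_cases hne : ∃ i j, i ≠ j ∧ Sum.inl i ∈ S ∧ Sum.inr j ∈ S
  · obtain ⟨i, j, hij, hi, hj⟩ := hne
    refine key (fun t => if t = i then Sum.inl i else if t = j then Sum.inr j else
      if Sum.inl t ∈ S then Sum.inl t else Sum.inr t) (fun _ _ => ⟨i, by simp [hi]⟩)
      (fun _ _ => ⟨j, by simp [hij.symm, hj]⟩) fun t ht => ?_
    grind
  · obtain ⟨i, hi⟩ := hX
    push Not at hne
    have hS : S ⊆ {Sum.inl i, Sum.inr i} := by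
      rintro (t | t) ht
      · obtain ⟨j, hj⟩ := hY
        have := hne i j
        have := hne t j
        grind
      · have := hne i t
        grind
    refine ⟨S, Subset.rfl, ((card_le_card hS).trans card_le_two).trans hk, fun e he => ?_⟩
    simp only [induced, mem_filter, mem_image, ← nonempty_iff_ne_empty] at he
    obtain ⟨⟨e, -, rfl⟩, he⟩ := he
    rwa [inter_assoc, inter_self]

theorem tauStar_le_of_subset_induced_boat {k : ℕ} (hk : 2 ≤ k) {S : Finset (BoatVert k)}
    {E : Finset (Finset (BoatVert k))} (hE : E ⊆ induced (boatEdges k) S) : tauStar S E ≤ k := by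
  obtain ⟨C, hCS, hCk, hC⟩ := exists_boat_transversal hk S
  exact (tauStar_le_card hCS fun e he => hC e (hE he)).trans (by exact_mod_cast hCk)

theorem tauStar_boat_eq {k : ℕ} (hk : 2 ≤ k) {E : Finset (Finset (BoatVert k))}
    (hE : E ⊆ boatEdges k) (hM : boatRungs k ⊆ E) : tauStar univ E = k := by
  refine le_antisymm (tauStar_le_of_subset_induced_boat hk ?_) ?_
  · rwa [induced_univ fun e he => nonempty_of_mem_boatEdges hk he]
  · have := card_le_tauStar (subset_univ univ)
      (fun e he => by simpa using nonempty_of_mem_boatEdges hk (hE he)) hM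
      (pairwiseDisjoint_boatRungs k)
    rwa [card_boatRungs] at this

theorem rhoStar_boat {k : ℕ} (hk : 2 ≤ k) :
    rhoStar (univ : Finset (BoatVert k)) (boatEdges k) = 2 := by
  let a : Fin k := ⟨0, by omega⟩
  let b : Fin k := ⟨1, by omega⟩
  have hab : a ≠ b := by simp [a, b]
  have hI : ({Sum.inl a, Sum.inr b} : Finset (BoatVert k)).card = 2 := card_pair (by simp)
  have hne : (univ.image Sum.inl : Finset (BoatVert k)) ≠ univ.image Sum.inr := by
    intro h
    have : (Sum.inl a : BoatVert k) ∈ (univ.image Sum.inr : Finset (BoatVert k)) := by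
      rw [← h]; simp
    simp at this
  have := rhoStar_eq_card (E := boatEdges k) (I := {Sum.inl a, Sum.inr b})
    (M := {univ.image Sum.inl, univ.image Sum.inr}) (subset_univ _) (fun e he => ?_)
    subset_union_left ?_ (by rw [hI, card_pair hne])
  · simpa [hI] using this
  · refine card_le_one.2 fun v hv w hw => ?_
    obtain rfl | rfl | ⟨j, rfl⟩ := mem_boatEdges.1 he <;> grind
  · rintro (i | i) - <;> simp

/-- For every integer `k ≥ 2`, the boat hypergraph `H_k^B` satisfies
`ρ*(H_k^B) = 2` and `τ*(H_k^B) = ψ*(H_k^B) = κ(H_k^B) = k`. -/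
theorem boat_measures (k : ℕ) (hk : 2 ≤ k) :
    rhoStar (Finset.univ : Finset (BoatVert k)) (boatEdges k) = 2 ∧
    tauStar (Finset.univ : Finset (BoatVert k)) (boatEdges k) = k ∧
    psiStar (Finset.univ : Finset (BoatVert k)) (boatEdges k) = k ∧
    kappa (Finset.univ : Finset (BoatVert k)) (boatEdges k) = k := by
  have hind : induced (boatEdges k) univ = boatEdges k :=
    induced_univ fun e he => nonempty_of_mem_boatEdges hk he
  refine ⟨rhoStar_boat hk, tauStar_boat_eq hk Subset.rfl (boatRungs_subset k),
    le_antisymm (sup'_le _ _ fun S _ => tauStar_le_of_subset_induced_boat hk Subset.rfl) ?_,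
    le_antisymm (sup'_le _ _ fun S _ => tauStar_le_of_subset_induced_boat hk (reduce_subset _)) ?_⟩
  · refine le_sup'_of_le _ (mem_powerset_self univ) ?_
    rw [hind, tauStar_boat_eq hk Subset.rfl (boatRungs_subset k)]
  · refine le_sup'_of_le _ (mem_powerset_self univ) ?_
    rw [hind, tauStar_boat_eq hk (reduce_subset _) (boatRungs_subset_reduce k)]
end

section
/- Let R_1, …, R_m be relations and let vars(Q) = vars(R_1) ∪ … ∪ vars(R_m). Let 𝒰 be a finite set of pairs (U, R_j) with U ⊆ vars(R_j), let H be the union of the sets U over all (U, R) ∈ 𝒰, and let R_H be the natural join of the projections π_U(R) over all (U, R) ∈ 𝒰 (if 𝒰 is empty, R_H is the relation over the empty attribute set consisting of the single empty tuple). For each i, define R_i† as follows: if vars(R_i) ⊆ H, let R_i† = R_H ⋉ R_i; otherwise, let R_i† = (S_i ⋈ R_H) ⋉ R_i, where S_i is any one of the relations R_1, …, R_m such that vars(R_i) ∖ H ⊆ vars(S_i) (assumed to exist), and ⋈ denotes natural join. Then the natural join of R_1†, …, R_m† equals the natural join of R_1, …, R_m, as relations over vars(Q). -/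
open Finset

variable {α δ : Type*} [Fintype α] [DecidableEq α] [DecidableEq δ] [Inhabited δ]

/-- A tuple over a set `U` of attributes is modelled as a total function `α → δ`
supported on `U`: `restr U t` sets all attributes outside `U` to `default`. -/
def restr (U : Finset α) (t : α → δ) : α → δ := fun a => if a ∈ U then t a else default

/-- The projection `π_U(R)` of a relation `R` onto the attributes `U`. -/
def proj (U : Finset α) (R : Finset (α → δ)) : Finset (α → δ) := R.image (restr U)

/-- `degRel R Y X` is `deg_R(Y | X)`: the maximum, over tuples `x` over `X`, of the
number of tuples in `π_Y(R)` whose restriction to `X` equals `x`. -/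
def degRel (R : Finset (α → δ)) (Y X : Finset α) : ℕ :=
  (proj X R).sup (fun x => ((proj Y R).filter (fun t => restr X t = x)).card)

/-- The relation `R` with attribute set `vars` satisfies the constraint set `σ` if
`deg_R(Y | X) ≤ 2 σ(X) / σ(Y)` for all `X ⊆ Y ⊆ vars`. -/
def satisfiesConstraints (R : Finset (α → δ)) (vars : Finset α) (σ : Finset α → ℝ) : Prop :=
  ∀ X Y : Finset α, X ⊆ Y → Y ⊆ vars → (degRel R Y X : ℝ) ≤ 2 * σ X / σ Y

/-- The natural join `T ⋈ S` of relations `T` (over attributes `vT`) and `S`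
(over attributes `vS`): compatible pairs of tuples are merged. -/
def natJoin (vT vS : Finset α) (T S : Finset (α → δ)) : Finset (α → δ) :=
  ((T ×ˢ S).filter (fun pr => restr (vT ∩ vS) pr.1 = restr (vT ∩ vS) pr.2)).image
    (fun pr => fun a => if a ∈ vT then pr.1 a else pr.2 a)

/-- The semijoin `T ⋉ R`, where `R` has attribute set `vR ⊆ vars(T)`: the tuples of
`T` whose restriction to `vR` belongs to `R`. -/
def semijoin (T : Finset (α → δ)) (vR : Finset α) (R : Finset (α → δ)) : Finset (α → δ) :=
  T.filter (fun t => restr vR t ∈ R)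

/-- Restricting to a set and then to a subset of it is restricting to the subset. -/
theorem restr_restr_of_subset {V W : Finset α} (h : V ⊆ W) (t : α → δ) :
    restr V (restr W t) = restr V t := by
  funext a
  by_cases ha : a ∈ V
  · simp [restr, ha, h ha]
  · simp [restr, ha]

/-- If the restrictions of a tuple belong to two relations, its restriction to the union of
their attribute sets belongs to the natural join. -/
theorem restr_union_mem_natJoin {vT vS : Finset α} {T S : Finset (α → δ)} {t : α → δ}
    (hT : restr vT t ∈ T) (hS : restr vS t ∈ S) :
    restr (vT ∪ vS) t ∈ natJoin vT vS T S := by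
  refine mem_image.2 ⟨(restr vT t, restr vS t),
    mem_filter.2 ⟨mem_product.2 ⟨hT, hS⟩, ?_⟩, ?_⟩
  · rw [restr_restr_of_subset inter_subset_left, restr_restr_of_subset inter_subset_right]
  · funext a
    by_cases ha : a ∈ vT <;> simp [restr, ha]

/-- Membership of a restricted tuple in a semijoin. -/
theorem restr_mem_semijoin_iff {V W : Finset α} (h : V ⊆ W) {T R : Finset (α → δ)}
    {t : α → δ} :
    restr W t ∈ semijoin T V R ↔ restr W t ∈ T ∧ restr V t ∈ R := by
  rw [semijoin, mem_filter, restr_restr_of_subset h]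

/-- Let `R_1, …, R_m` be relations, `vars(Q)` the union of their
attribute sets, `𝒰 = {(U_j, R_{r j})}_{j < k}` a finite set of pairs with
`U_j ⊆ vars(R_{r j})`, `H` the union of the `U_j`, and `R_H` the natural join of the
projections `π_{U_j}(R_{r j})` (the single empty tuple when `𝒰 = ∅`). For each `i`,
let `R_i† = R_H ⋉ R_i` if `vars(R_i) ⊆ H`, and otherwise
`R_i† = (S_i ⋈ R_H) ⋉ R_i` where `S_i = R_{g i}` satisfies `vars(R_i) ∖ H ⊆ vars(S_i)`.
Then the natural join of `R_1†, …, R_m†` equals the natural join of `R_1, …, R_m` as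
relations over `vars(Q)`. -/
theorem join_of_daggers_eq_join
    (m : ℕ) (Rel : Fin m → Finset (α → δ)) (vars : Fin m → Finset α)
    (hsupp : ∀ i, ∀ t ∈ Rel i, restr (vars i) t = t)
    (varsQ : Finset α) (hvarsQ : varsQ = Finset.univ.biUnion vars)
    (k : ℕ) (r : Fin k → Fin m) (U : Fin k → Finset α)
    (hU : ∀ j, U j ⊆ vars (r j))
    (H : Finset α) (hH : H = Finset.univ.biUnion U)
    (RH : Finset (α → δ))
    (hRH : ∀ t : α → δ, t ∈ RH ↔
      (restr H t = t ∧ ∀ j, restr (U j) t ∈ proj (U j) (Rel (r j))))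
    (g : Fin m → Fin m)
    (hg : ∀ i, ¬ vars i ⊆ H → vars i \ H ⊆ vars (g i))
    (dRel : Fin m → Finset (α → δ))
    (hdRel : ∀ i, dRel i =
      if vars i ⊆ H then semijoin RH (vars i) (Rel i)
      else semijoin (natJoin (vars (g i)) H (Rel (g i)) RH) (vars i) (Rel i))
    (dvars : Fin m → Finset α)
    (hdvars : ∀ i, dvars i = if vars i ⊆ H then H else vars (g i) ∪ H) :
    ∀ t : α → δ,
      (restr varsQ t = t ∧ ∀ i, restr (dvars i) t ∈ dRel i) ↔
      (restr varsQ t = t ∧ ∀ i, restr (vars i) t ∈ Rel i) := by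
  intro t
  refine and_congr_right fun _ => ⟨fun h i => ?_, fun h i => ?_⟩
  · have hi := h i
    rw [hdRel, hdvars] at hi
    split_ifs at hi with hc
    · exact ((restr_mem_semijoin_iff hc).1 hi).2
    · have hsub : vars i ⊆ vars (g i) ∪ H := by
        rw [union_comm]
        exact sdiff_le_iff.1 (hg i hc)
      exact ((restr_mem_semijoin_iff hsub).1 hi).2
  · have hUH : ∀ j, U j ⊆ H := fun j => hH ▸ subset_biUnion_of_mem U (mem_univ j)
    have htH : restr H t ∈ RH := by
      refine (hRH _).2 ⟨restr_restr_of_subset subset_rfl t, fun j => ?_⟩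
      rw [restr_restr_of_subset (hUH j), ← restr_restr_of_subset (hU j)]
      exact mem_image_of_mem _ (h (r j))
    rw [hdRel, hdvars]
    split_ifs with hc
    · exact (restr_mem_semijoin_iff hc).2 ⟨htH, h i⟩
    · have hsub : vars i ⊆ vars (g i) ∪ H := by
        rw [union_comm]
        exact sdiff_le_iff.1 (hg i hc)
      exact (restr_mem_semijoin_iff hsub).2 ⟨restr_union_mem_natJoin (h (g i)) htH, h i⟩
end
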